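/- Positive overrides lower surplus unless adverse selection is irrelevant: let the experiment E' differ from E by a local mean preserving spread at s_j ∈ S, and let σ̂_E be the most selective equilibrium strategy of E. If σ̂_E(s_j) = 0 (the spread is a positive override) and adverse selection is not σ̂_E-irrelevant for the new outcome s_{j+1}, in the sense that ρ·(1−c)·r_H(σ̂_E)^{n−1}·p'_H(s_{j+1}) ≤ c·(1−ρ)·r_L(σ̂_E)^{n−1}·p'_L(s_{j+1}), then total surplus in the most selective equilibrium under E' is weakly less than under E: Π'(σ̂_{E'}) ≤ Π(σ̂_E). The analogous statement holds for the least selective equilibrium strategies σ̌_E, σ̌_{E'} (with r_θ(σ̌_E) in the irrelevance condition). -/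

import Mathlib

open Finset Filter Topology

noncomputable section

/-- Probability that a single buyer rejects the seller, given conditional signal
distribution `p` and strategy `σ`: `r_θ(σ) = 1 - Σ_s p_θ(s)·σ(s)`. -/
def rej {m : ℕ} (p σ : Fin m → ℝ) : ℝ := 1 - ∑ s, p s * σ s

/-- `ν_θ(σ) = (1/n)·Σ_{k=0}^{n-1} r_θ(σ)^k`: probability of being visited. -/
def visit (n : ℕ) {m : ℕ} (p σ : Fin m → ℝ) : ℝ :=
  (1 / (n : ℝ)) * ∑ k ∈ Finset.range n, rej p σ ^ k

/-- Interim belief `Ψ(σ) = ρ·ν_H(σ) / (ρ·ν_H(σ) + (1-ρ)·ν_L(σ))`. -/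
def interim (ρ : ℝ) (n : ℕ) {m : ℕ} (pL pH σ : Fin m → ℝ) : ℝ :=
  ρ * visit n pH σ / (ρ * visit n pH σ + (1 - ρ) * visit n pL σ)

/-- Posterior belief `Q_ψ(s) = ψ·p_H(s) / (ψ·p_H(s) + (1-ψ)·p_L(s))`. -/
def post {m : ℕ} (ψ : ℝ) (pL pH : Fin m → ℝ) (s : Fin m) : ℝ :=
  ψ * pH s / (ψ * pH s + (1 - ψ) * pL s)

/-- A strategy maps each signal to an acceptance probability in `[0,1]`. -/
def IsStrategy {m : ℕ} (σ : Fin m → ℝ) : Prop := ∀ s, 0 ≤ σ s ∧ σ s ≤ 1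

/-- `σ` is an equilibrium strategy: with `ψ* = Ψ(σ)`, accept for sure when the
posterior exceeds `c`, reject for sure when it falls below `c`. -/
def IsEquilibrium (ρ c : ℝ) (n : ℕ) {m : ℕ} (pL pH σ : Fin m → ℝ) : Prop :=
  IsStrategy σ ∧
  ∀ s : Fin m,
    (c < post (interim ρ n pL pH σ) pL pH s → σ s = 1) ∧
    (post (interim ρ n pL pH σ) pL pH s < c → σ s = 0)

/-- Total surplus `Π(σ) = (1-c)·ρ·(1-r_H(σ)^n) - c·(1-ρ)·(1-r_L(σ)^n)`. -/
def surplus (ρ c : ℝ) (n : ℕ) {m : ℕ} (pL pH σ : Fin m → ℝ) : ℝ :=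
  (1 - c) * ρ * (1 - rej pH σ ^ n) - c * (1 - ρ) * (1 - rej pL σ ^ n)

/-- The most selective equilibrium strategy. -/
def MostSelective (ρ c : ℝ) (n : ℕ) {m : ℕ} (pL pH σ : Fin m → ℝ) : Prop :=
  IsEquilibrium ρ c n pL pH σ ∧
  ∀ σ' : Fin m → ℝ, IsEquilibrium ρ c n pL pH σ' → ∀ s, σ s ≤ σ' s

/-- The least selective equilibrium strategy. -/
def LeastSelective (ρ c : ℝ) (n : ℕ) {m : ℕ} (pL pH σ : Fin m → ℝ) : Prop :=
  IsEquilibrium ρ c n pL pH σ ∧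
  ∀ σ' : Fin m → ℝ, IsEquilibrium ρ c n pL pH σ' → ∀ s, σ' s ≤ σ s

/-- An experiment: `p_L, p_H` are probability mass functions with full joint support,
indexed so that likelihood ratios are nondecreasing. -/
def IsExperiment {m : ℕ} (pL pH : Fin m → ℝ) : Prop :=
  (∀ s, 0 ≤ pL s) ∧ (∀ s, 0 ≤ pH s) ∧
  (∑ s, pL s = 1) ∧ (∑ s, pH s = 1) ∧
  (∀ s, 0 < pL s + pH s) ∧
  (∀ i j : Fin m, i ≤ j → pH i * pL j ≤ pH j * pL i)

/-- A strategy is monotone: a positive acceptance probability at `s_i` forces sure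
acceptance at every signal with strictly higher likelihood ratio. -/
def MonotoneStrategy {m : ℕ} (pL pH σ : Fin m → ℝ) : Prop :=
  ∀ i j : Fin m, 0 < σ i → pH i * pL j < pH j * pL i → σ j = 1

/-- A probability mass function on `Fin m`. -/
structure IsPmf {m : ℕ} (p : Fin m → ℝ) : Prop where
  nonneg : ∀ s, 0 ≤ p s
  sum_eq_one : ∑ s, p s = 1

lemma rej_eq_sum {m : ℕ} {p : Fin m → ℝ} (hp : IsPmf p) (σ : Fin m → ℝ) :
    rej p σ = ∑ s, p s * (1 - σ s) := by
  simp only [rej, mul_sub, mul_one, Finset.sum_sub_distrib, hp.sum_eq_one]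

lemma rej_nonneg {m : ℕ} {p σ : Fin m → ℝ} (hp : IsPmf p) (hσ : IsStrategy σ) :
    0 ≤ rej p σ := by
  rw [rej_eq_sum hp]
  exact Finset.sum_nonneg fun s _ => mul_nonneg (hp.nonneg s) (sub_nonneg.2 (hσ s).2)

lemma rej_anti {m : ℕ} {p σ τ : Fin m → ℝ} (hp : IsPmf p) (h : ∀ s, σ s ≤ τ s) :
    rej p τ ≤ rej p σ :=
  sub_le_sub_left (Finset.sum_le_sum fun s _ => mul_le_mul_of_nonneg_left (h s) (hp.nonneg s)) 1

lemma rej_congr {m : ℕ} {p q σ : Fin m → ℝ} (h : ∀ s, p s * σ s = q s * σ s) :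
    rej p σ = rej q σ := by
  simp only [rej, h]

lemma visit_pos {n m : ℕ} (hn : 1 ≤ n) {p σ : Fin m → ℝ} (h : 0 ≤ rej p σ) :
    0 < visit n p σ := by
  have hn' : (0 : ℝ) < n := by exact_mod_cast hn
  refine mul_pos (by positivity) ?_
  exact Finset.sum_pos' (fun k _ => pow_nonneg h k) ⟨0, Finset.mem_range.2 hn, by simp⟩

/-- The value a buyer attaches to accepting in the high state. -/
def gainH (ρ c : ℝ) (n : ℕ) {m : ℕ} (p σ : Fin m → ℝ) : ℝ := ρ * (1 - c) * visit n p σ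

/-- The loss a buyer attaches to accepting in the low state. -/
def lossL (ρ c : ℝ) (n : ℕ) {m : ℕ} (p σ : Fin m → ℝ) : ℝ := c * (1 - ρ) * visit n p σ

lemma gainH_pos {ρ c : ℝ} (hρ : ρ ∈ Set.Ioo (0 : ℝ) 1) (hc : c ∈ Set.Ioo (0 : ℝ) 1)
    {n m : ℕ} (hn : 1 ≤ n) {p σ : Fin m → ℝ} (hp : IsPmf p) (hσ : IsStrategy σ) :
    0 < gainH ρ c n p σ :=
  mul_pos (mul_pos hρ.1 (sub_pos.2 hc.2)) (visit_pos hn (rej_nonneg hp hσ))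

lemma lossL_pos {ρ c : ℝ} (hρ : ρ ∈ Set.Ioo (0 : ℝ) 1) (hc : c ∈ Set.Ioo (0 : ℝ) 1)
    {n m : ℕ} (hn : 1 ≤ n) {p σ : Fin m → ℝ} (hp : IsPmf p) (hσ : IsStrategy σ) :
    0 < lossL ρ c n p σ :=
  mul_pos (mul_pos hc.1 (sub_pos.2 hρ.2)) (visit_pos hn (rej_nonneg hp hσ))

lemma isEquilibrium_iff {ρ c : ℝ} (hρ : ρ ∈ Set.Ioo (0 : ℝ) 1) (hc : c ∈ Set.Ioo (0 : ℝ) 1)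
    {n m : ℕ} (hn : 1 ≤ n) {pL pH σ : Fin m → ℝ} (hL : IsPmf pL) (hH : IsPmf pH) :
    IsEquilibrium ρ c n pL pH σ ↔ IsStrategy σ ∧ ∀ s,
      (σ s < 1 → gainH ρ c n pH σ * pH s ≤ lossL ρ c n pL σ * pL s) ∧
      (0 < σ s → lossL ρ c n pL σ * pL s ≤ gainH ρ c n pH σ * pH s ∧ 0 < pL s + pH s) := by
  refine and_congr_right fun hσ => forall_congr' fun s => ?_
  have hvH := visit_pos hn (rej_nonneg hH hσ)
  have hvL := visit_pos hn (rej_nonneg hL hσ)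
  obtain ⟨hρ0, hρ1⟩ := hρ
  have hρ1' := sub_pos.2 hρ1
  have hpL := hL.nonneg s
  have hpH := hH.nonneg s
  have hs0 := (hσ s).1
  have hs1 := (hσ s).2
  unfold gainH lossL
  by_cases hnull : pL s = 0 ∧ pH s = 0
  · obtain ⟨h1, h2⟩ := hnull
    simp only [post, h1, h2, mul_zero, add_zero, div_zero, not_lt.2 hc.1.le, hc.1, le_refl,
      lt_irrefl, and_false, implies_true, true_and, false_imp_iff, true_imp_iff]
    exact ⟨fun h => h.le.not_gt, fun h => le_antisymm (not_lt.1 h) hs0⟩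
  have hpos : 0 < pL s + pH s := by
    rcases hpL.lt_or_eq with h | h
    · linarith
    · rcases hpH.lt_or_eq with h' | h'
      · linarith
      · exact absurd ⟨h.symm, h'.symm⟩ hnull
  have hden : 0 < ρ * visit n pH σ * pH s + (1 - ρ) * visit n pL σ * pL s := by
    rcases hpL.lt_or_eq with h | h
    · have := mul_pos (mul_pos hρ1' hvL) h
      have := mul_nonneg (mul_pos hρ0 hvH).le hpH
      linarith
    · have h' : 0 < pH s := by linarith
      have := mul_pos (mul_pos hρ0 hvH) h'
      have := mul_nonneg (mul_pos hρ1' hvL).le hpL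
      linarith
  have hW : 0 < ρ * visit n pH σ + (1 - ρ) * visit n pL σ :=
    add_pos (mul_pos hρ0 hvH) (mul_pos hρ1' hvL)
  have hpost : post (interim ρ n pL pH σ) pL pH s = ρ * visit n pH σ * pH s /
      (ρ * visit n pH σ * pH s + (1 - ρ) * visit n pL σ * pL s) := by
    have h1 : 1 - interim ρ n pL pH σ = (1 - ρ) * visit n pL σ /
        (ρ * visit n pH σ + (1 - ρ) * visit n pL σ) := by
      rw [interim, eq_div_iff hW.ne', sub_mul, div_mul_cancel₀ _ hW.ne']; ring
    rw [post, h1, interim, div_mul_eq_mul_div, div_mul_eq_mul_div, ← add_div,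
      div_div_div_cancel_right₀ hW.ne']
  rw [hpost, lt_div_iff₀ hden, div_lt_iff₀ hden]
  constructor
  · rintro ⟨h1, h2⟩
    refine ⟨fun h => ?_, fun h => ⟨?_, hpos⟩⟩
    · by_contra! h'
      exact h.ne (h1 (by linarith))
    · by_contra! h'
      exact h.ne' (h2 (by linarith))
  · rintro ⟨h1, h2⟩
    refine ⟨fun h => ?_, fun h => ?_⟩
    · by_contra h'
      have := h1 (lt_of_le_of_ne hs1 h')
      linarith
    · by_contra hne
      have := (h2 (lt_of_le_of_ne hs0 (Ne.symm hne))).1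
      linarith

/-- Accepting more under an equilibrium strategy lowers the likelihood ratio of rejection. -/
lemma rej_mul_rej_le {ρ c : ℝ} (hρ : ρ ∈ Set.Ioo (0 : ℝ) 1) (hc : c ∈ Set.Ioo (0 : ℝ) 1)
    {n m : ℕ} (hn : 1 ≤ n) {pL pH σ τ : Fin m → ℝ} (hL : IsPmf pL) (hH : IsPmf pH)
    (hσ : IsStrategy σ) (hτ : IsEquilibrium ρ c n pL pH τ) (hle : ∀ s, σ s ≤ τ s) :
    rej pH τ * rej pL σ ≤ rej pL τ * rej pH σ := by
  obtain ⟨hτs, he⟩ := (isEquilibrium_iff hρ hc hn hL hH).1 hτ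
  have hA := gainH_pos hρ hc hn hH hτs
  have hB := lossL_pos hρ hc hn hL hτs
  have key : (∑ s, pH s * (1 - τ s)) * (∑ t, pL t * (τ t - σ t)) ≤
      (∑ s, pL s * (1 - τ s)) * (∑ t, pH t * (τ t - σ t)) := by
    rw [Finset.sum_mul_sum, Finset.sum_mul_sum]
    refine Finset.sum_le_sum fun s _ => Finset.sum_le_sum fun t _ => ?_
    rcases (hτs s).2.lt_or_eq with hs | hs
    · rcases (hle t).lt_or_eq with ht | ht
      · have h1 := (he s).1 hs
        have h2 := ((he t).2 ((hσ t).1.trans_lt ht)).1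
        have h3 : pH s * pL t ≤ pL s * pH t := by
          have h4 := mul_le_mul h1 h2 (mul_nonneg hB.le (hL.nonneg t))
            (mul_nonneg hB.le (hL.nonneg s))
          refine le_of_mul_le_mul_left ?_ (mul_pos hA hB)
          linarith
        have h5 := mul_le_mul_of_nonneg_right h3
          (mul_nonneg (sub_nonneg.2 hs.le) (sub_nonneg.2 ht.le))
        linarith
      · simp [ht]
    · simp [hs]
  have hdiff : ∀ p : Fin m → ℝ, rej p σ = rej p τ + ∑ t, p t * (τ t - σ t) := by
    intro p
    simp only [rej, mul_sub, Finset.sum_sub_distrib]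
    ring
  rw [← rej_eq_sum hH, ← rej_eq_sum hL] at key
  rw [hdiff pL, hdiff pH]
  linarith

lemma rej_high_le_rej_low {ρ c : ℝ} (hρ : ρ ∈ Set.Ioo (0 : ℝ) 1) (hc : c ∈ Set.Ioo (0 : ℝ) 1)
    {n m : ℕ} (hn : 1 ≤ n) {pL pH τ : Fin m → ℝ} (hL : IsPmf pL) (hH : IsPmf pH)
    (hτ : IsEquilibrium ρ c n pL pH τ) : rej pH τ ≤ rej pL τ := by
  have := rej_mul_rej_le (σ := fun _ => 0) hρ hc hn hL hH (fun _ => ⟨le_rfl, zero_le_one⟩) hτ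
    (fun s => (hτ.1 s).1)
  simpa [rej] using this

/-- In equilibrium, the social value of acceptance is nonpositive whenever the private one is. -/
lemma social_le_of_private_le {ρ c : ℝ} (hρ : ρ ∈ Set.Ioo (0 : ℝ) 1)
    (hc : c ∈ Set.Ioo (0 : ℝ) 1) {n m : ℕ} (hn : 1 ≤ n) {pL pH σ : Fin m → ℝ}
    (hL : IsPmf pL) (hH : IsPmf pH) (hσ : IsEquilibrium ρ c n pL pH σ) {x y : ℝ} (hy : 0 ≤ y)
    (h : gainH ρ c n pH σ * y ≤ lossL ρ c n pL σ * x) :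
    ρ * (1 - c) * rej pH σ ^ (n - 1) * y ≤ c * (1 - ρ) * rej pL σ ^ (n - 1) * x := by
  have hrH := rej_nonneg hH hσ.1
  have hrL := rej_nonneg hL hσ.1
  have hle := rej_high_le_rej_low hρ hc hn hL hH hσ
  have hvL := visit_pos hn hrL
  have hcross : rej pH σ ^ (n - 1) * visit n pL σ ≤ rej pL σ ^ (n - 1) * visit n pH σ := by
    have hsum : rej pH σ ^ (n - 1) * ∑ k ∈ Finset.range n, rej pL σ ^ k ≤
        rej pL σ ^ (n - 1) * ∑ k ∈ Finset.range n, rej pH σ ^ k := by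
      rw [Finset.mul_sum, Finset.mul_sum]
      refine Finset.sum_le_sum fun k hk => ?_
      obtain ⟨d, hd⟩ : ∃ d, n - 1 = k + d :=
        ⟨n - 1 - k, by have := Finset.mem_range.1 hk; omega⟩
      rw [hd, pow_add, pow_add]
      have h1 := mul_le_mul_of_nonneg_left (pow_le_pow_left₀ hrH hle d)
        (mul_nonneg (pow_nonneg hrH k) (pow_nonneg hrL k))
      linarith
    unfold visit
    have := mul_le_mul_of_nonneg_left hsum (show 0 ≤ 1 / (n : ℝ) by positivity)
    linarith
  have hα : 0 ≤ ρ * (1 - c) := mul_nonneg hρ.1.le (sub_pos.2 hc.2).le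
  refine le_of_mul_le_mul_left ?_ hvL
  have h1 := mul_le_mul_of_nonneg_left hcross (mul_nonneg hα hy)
  have h2 := mul_le_mul_of_nonneg_left h (pow_nonneg hrL (n - 1))
  unfold gainH lossL at h2
  linarith

lemma mul_pow_sub_pow_le {α β a b a' b' : ℝ} (hα : 0 ≤ α) (hβ : 0 ≤ β) {n : ℕ} (hn : 1 ≤ n)
    (ha' : 0 ≤ a') (hb' : 0 ≤ b') (haa : a' ≤ a) (hbb : b' ≤ b) (hcross : a' * b ≤ b' * a)
    (h : α * a ^ (n - 1) * (a - a') ≤ β * b ^ (n - 1) * (b - b')) :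
    α * (a ^ n - a' ^ n) ≤ β * (b ^ n - b' ^ n) := by
  obtain ⟨d, rfl⟩ : ∃ d, n = d + 1 := ⟨n - 1, by omega⟩
  simp only [Nat.add_sub_cancel] at h
  have hbn : b' ^ (d + 1) ≤ b ^ (d + 1) := pow_le_pow_left₀ hb' hbb _
  rcases (ha'.trans haa).eq_or_lt with ha0 | ha0
  · have : a' = 0 := by linarith
    rw [← ha0, this]
    simpa using mul_nonneg hβ (sub_nonneg.2 hbn)
  rcases (hb'.trans hbb).eq_or_lt with hb0 | hb0
  · have hb0' : b' = 0 := by linarith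
    rw [← hb0, hb0'] at h
    simp only [sub_zero, mul_zero] at h
    have h2 : α * (a - a') ≤ 0 := by
      by_contra! h'
      have := mul_pos h' (pow_pos ha0 d)
      linarith
    rw [← hb0, hb0', sub_self, mul_zero]
    rcases hα.eq_or_lt with h3 | h3
    · simp [← h3]
    · have : a = a' := by
        have : a - a' ≤ 0 := by
          by_contra! h'
          have := mul_pos h3 h'
          linarith
        linarith
      simp [this]
  have hfac : ∀ x y : ℝ, 0 < x → x ^ (d + 1) - y ^ (d + 1) =
      x ^ d * (x - y) * ∑ k ∈ Finset.range (d + 1), (y / x) ^ k := by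
    intro x y hx
    have h1 := mul_neg_geom_sum (y / x) (d + 1)
    have h2 : x - y = x * (1 - y / x) := by field_simp
    rw [h2]
    calc x ^ (d + 1) - y ^ (d + 1) = x ^ (d + 1) * (1 - (y / x) ^ (d + 1)) := by
          rw [div_pow]; field_simp
      _ = _ := by rw [← h1]; ring
  rw [hfac a a' ha0, hfac b b' hb0]
  have hratio : a' / a ≤ b' / b := by rwa [div_le_div_iff₀ ha0 hb0]
  have hsum : ∑ k ∈ Finset.range (d + 1), (a' / a) ^ k ≤
      ∑ k ∈ Finset.range (d + 1), (b' / b) ^ k :=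
    Finset.sum_le_sum fun k _ => pow_le_pow_left₀ (div_nonneg ha' ha0.le) hratio k
  have h0 : 0 ≤ ∑ k ∈ Finset.range (d + 1), (a' / a) ^ k :=
    Finset.sum_nonneg fun k _ => pow_nonneg (div_nonneg ha' ha0.le) k
  have h1 := mul_le_mul_of_nonneg_right h h0
  have h2 := mul_le_mul_of_nonneg_left hsum
    (mul_nonneg (mul_nonneg hβ (pow_nonneg hb0.le d)) (sub_nonneg.2 hbb))
  linarith

/-- Moving up to an equilibrium strategy lowers surplus if each newly accepted signal has
nonpositive social value at the initial strategy. -/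
lemma surplus_le_of_social_le {ρ c : ℝ} (hρ : ρ ∈ Set.Ioo (0 : ℝ) 1)
    (hc : c ∈ Set.Ioo (0 : ℝ) 1) {n m : ℕ} (hn : 1 ≤ n) {pL pH σ τ : Fin m → ℝ}
    (hL : IsPmf pL) (hH : IsPmf pH) (hσ : IsStrategy σ) (hτ : IsEquilibrium ρ c n pL pH τ)
    (hle : ∀ s, σ s ≤ τ s)
    (hsoc : ∀ s, σ s < τ s →
      ρ * (1 - c) * rej pH σ ^ (n - 1) * pH s ≤ c * (1 - ρ) * rej pL σ ^ (n - 1) * pL s) :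
    surplus ρ c n pL pH τ ≤ surplus ρ c n pL pH σ := by
  have hdiff : ∀ p : Fin m → ℝ, rej p σ - rej p τ = ∑ t, p t * (τ t - σ t) := by
    intro p
    simp only [rej, mul_sub, Finset.sum_sub_distrib]
    ring
  have h : ρ * (1 - c) * rej pH σ ^ (n - 1) * (rej pH σ - rej pH τ) ≤
      c * (1 - ρ) * rej pL σ ^ (n - 1) * (rej pL σ - rej pL τ) := by
    rw [hdiff, hdiff, Finset.mul_sum, Finset.mul_sum]
    refine Finset.sum_le_sum fun s _ => ?_
    rcases (hle s).lt_or_eq with hs | hs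
    · have := mul_le_mul_of_nonneg_right (hsoc s hs) (sub_nonneg.2 hs.le)
      linarith
    · simp [hs]
  have := mul_pow_sub_pow_le (mul_nonneg hρ.1.le (sub_pos.2 hc.2).le)
    (mul_nonneg hc.1.le (sub_pos.2 hρ.2).le) hn (rej_nonneg hH hτ.1) (rej_nonneg hL hτ.1)
    (rej_anti hH hle) (rej_anti hL hle) (rej_mul_rej_le hρ hc hn hL hH hσ hτ hle) h
  unfold surplus
  linarith

/-- Acceptance probability can be shifted between two signals at which buyers are indifferent
without leaving the set of equilibrium strategies. -/
lemma exists_shifted_equilibrium {ρ c : ℝ} (hρ : ρ ∈ Set.Ioo (0 : ℝ) 1)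
    (hc : c ∈ Set.Ioo (0 : ℝ) 1) {n m : ℕ} (hn : 1 ≤ n) {pL pH σ : Fin m → ℝ}
    (hL : IsPmf pL) (hH : IsPmf pH) (hσ : IsEquilibrium ρ c n pL pH σ) {s t : Fin m}
    (hst : s ≠ t) (ht : 0 < σ t) (hs : σ s < 1) (hnull : 0 < pL s + pH s)
    (hs' : lossL ρ c n pL σ * pL s ≤ gainH ρ c n pH σ * pH s)
    (ht' : gainH ρ c n pH σ * pH t ≤ lossL ρ c n pL σ * pL t) :
    ∃ τ, IsEquilibrium ρ c n pL pH τ ∧ τ t < σ t ∧ σ s < τ s := by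
  obtain ⟨hσs, he⟩ := (isEquilibrium_iff hρ hc hn hL hH).1 hσ
  have hA := gainH_pos hρ hc hn hH hσs
  have hB := lossL_pos hρ hc hn hL hσs
  have es := hs'.antisymm ((he s).1 hs)
  have et := ((he t).2 ht).1.antisymm ht'
  have hpos : ∀ u, lossL ρ c n pL σ * pL u = gainH ρ c n pH σ * pH u → 0 < pL u + pH u →
      0 < pL u := by
    intro u hu h0
    refine (hL.nonneg u).lt_of_ne fun h => ?_
    rw [← h, mul_zero] at hu
    have : pH u = 0 := by
      rcases mul_eq_zero.1 hu.symm with h' | h'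
      · exact absurd h' hA.ne'
      · exact h'
    linarith
  have ps := hpos s es hnull
  have pt := hpos t et ((he t).2 ht).2
  have hle1 : ∀ u, pL u ≤ 1 := fun u => by
    rw [← hL.sum_eq_one]
    exact Finset.single_le_sum (fun i _ => hL.nonneg i) (Finset.mem_univ u)
  obtain ⟨x, hx0, hx1, hx2⟩ : ∃ x : ℝ, 0 < x ∧ x ≤ 1 - σ s ∧ x ≤ σ t :=
    ⟨min (1 - σ s) (σ t), lt_min (by linarith) ht, min_le_left _ _, min_le_right _ _⟩
  have hxt : x * pL t ≤ x := mul_le_of_le_one_right hx0.le (hle1 t)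
  have hxs : x * pL s ≤ x := mul_le_of_le_one_right hx0.le (hle1 s)
  have hxt0 := mul_pos hx0 pt
  have hxs0 := mul_pos hx0 ps
  let τ : Fin m → ℝ := fun u => σ u + (Pi.single s (x * pL t) : Fin m → ℝ) u -
    (Pi.single t (x * pL s) : Fin m → ℝ) u
  have τs : τ s = σ s + x * pL t := by simp [τ, hst]
  have τt : τ t = σ t - x * pL s := by simp [τ, hst.symm]
  have τo : ∀ u, u ≠ s → u ≠ t → τ u = σ u := fun u h1 h2 => by simp [τ, h1, h2]
  have hrej : ∀ p : Fin m → ℝ, p s * pL t = p t * pL s → rej p τ = rej p σ := by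
    intro p h
    have : ∑ u, p u * τ u = ∑ u, p u * σ u + p s * (x * pL t) - p t * (x * pL s) := by
      simp only [τ, mul_sub, mul_add, Finset.sum_sub_distrib, Finset.sum_add_distrib,
        Pi.single_apply, mul_ite, mul_zero, Finset.sum_ite_eq', Finset.mem_univ, if_true]
    rw [rej, rej, this]
    linear_combination (-x) * h
  have hrL : rej pL τ = rej pL σ := hrej pL (mul_comm _ _)
  have hrH : rej pH τ = rej pH σ := by
    refine hrej pH (mul_left_cancel₀ hA.ne' ?_)
    linear_combination (-pL t) * es + pL s * et
  have hg : gainH ρ c n pH τ = gainH ρ c n pH σ := by simp only [gainH, visit, hrH]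
  have hl : lossL ρ c n pL τ = lossL ρ c n pL σ := by simp only [lossL, visit, hrL]
  refine ⟨τ, (isEquilibrium_iff hρ hc hn hL hH).2 ⟨fun u => ?_, fun u => ?_⟩, by linarith,
    by linarith⟩
  · by_cases h1 : u = s
    · subst h1
      have := (hσs u).1
      exact ⟨by linarith, by linarith⟩
    · by_cases h2 : u = t
      · subst h2
        have := (hσs u).2
        exact ⟨by linarith, by linarith⟩
      · rw [τo u h1 h2]
        exact hσs u
  · rw [hg, hl]
    by_cases h1 : u = s
    · subst h1
      exact ⟨fun _ => es.ge, fun _ => ⟨es.le, hnull⟩⟩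
    · by_cases h2 : u = t
      · subst h2
        exact ⟨fun _ => et.ge, fun _ => ⟨et.le, ((he u).2 ht).2⟩⟩
      · rw [τo u h1 h2]
        exact he u

lemma le_of_ratio_le {A B x y u v : ℝ} (hA : 0 ≤ A) (hx : 0 ≤ x)
    (hu : 0 ≤ u) (hv : 0 ≤ v) (hxy : 0 < x + y) (hr : y * u ≤ v * x) (h : B * x ≤ A * y) :
    B * u ≤ A * v := by
  rcases hx.eq_or_lt with h0 | h0
  · rw [← h0, mul_zero] at hr
    have hy' : 0 < y := by linarith
    have : u = 0 := le_antisymm (by by_contra! h'; have := mul_pos hy' h'; linarith) hu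
    rw [this, mul_zero]
    exact mul_nonneg hA hv
  · refine le_of_mul_le_mul_right ?_ h0
    have h1 := mul_le_mul_of_nonneg_left hr hA
    have h2 := mul_le_mul_of_nonneg_right h hu
    linarith

/-- The strategy that accepts above index `k`, accepts with probability `x` at `k`, and
rejects below `k`. -/
def threshold {m : ℕ} (k : ℕ) (x : ℝ) (s : Fin m) : ℝ :=
  if s.val < k then 0 else if s.val = k then x else 1

lemma isStrategy_threshold {m : ℕ} (k : ℕ) {x : ℝ} (hx : x ∈ Set.Icc (0 : ℝ) 1) :
    IsStrategy (threshold k x : Fin m → ℝ) := by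
  intro s
  unfold threshold
  split_ifs
  · simp
  · exact hx
  · simp

lemma threshold_succ {m : ℕ} (k : ℕ) :
    (threshold (k + 1) 1 : Fin m → ℝ) = threshold k 0 := by
  funext s
  unfold threshold
  split_ifs <;> first | rfl | omega

lemma threshold_one_le {m : ℕ} (k : ℕ) {x : ℝ} (hx : 0 ≤ x) (s : Fin m) :
    (threshold (k + 1) 1 : Fin m → ℝ) s ≤ threshold k x s := by
  unfold threshold
  split_ifs <;> first | exact le_rfl | exact hx | omega

lemma continuous_rej_threshold {m : ℕ} (k : ℕ) (p : Fin m → ℝ) :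
    Continuous fun x => rej p (threshold k x) := by
  unfold rej threshold
  refine continuous_const.sub (continuous_finsetSum _ fun s _ => continuous_const.mul ?_)
  split_ifs <;> fun_prop

lemma continuous_visit_threshold {m : ℕ} (n k : ℕ) (p : Fin m → ℝ) :
    Continuous fun x => visit n p (threshold k x) := by
  unfold visit
  exact continuous_const.mul
    (continuous_finsetSum _ fun i _ => (continuous_rej_threshold k p).pow i)

/-- If buyers are willing to accept at every signal accepted by a threshold strategy, some
strategy above it satisfies the best-response conditions. -/
lemma exists_bestResponse_ge_threshold {ρ c : ℝ} (hρ : ρ ∈ Set.Ioo (0 : ℝ) 1)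
    (hc : c ∈ Set.Ioo (0 : ℝ) 1) {n m : ℕ} (hn : 1 ≤ n) {pL pH a b : Fin m → ℝ}
    (hL : IsPmf pL) (hH : IsPmf pH) (ha : ∀ s, 0 ≤ a s) (hb : ∀ s, 0 ≤ b s)
    (hab : ∀ s, 0 < a s + b s) (hr : ∀ s t, s ≤ t → b s * a t ≤ b t * a s)
    (k : ℕ) (hk : k ≤ m)
    (hacc : ∀ s : Fin m, k ≤ s.val →
      lossL ρ c n pL (threshold k 1) * a s ≤ gainH ρ c n pH (threshold k 1) * b s) :
    ∃ τ : Fin m → ℝ, IsStrategy τ ∧ (∀ s, threshold k 1 s ≤ τ s) ∧ ∀ s,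
      (τ s < 1 → gainH ρ c n pH τ * b s ≤ lossL ρ c n pL τ * a s) ∧
      (0 < τ s → lossL ρ c n pL τ * a s ≤ gainH ρ c n pH τ * b s) := by
  have h01 : (0 : ℝ) ∈ Set.Icc (0 : ℝ) 1 := ⟨le_rfl, zero_le_one⟩
  have h11 : (1 : ℝ) ∈ Set.Icc (0 : ℝ) 1 := ⟨zero_le_one, le_rfl⟩
  have hA : ∀ (k : ℕ) {x : ℝ}, x ∈ Set.Icc (0 : ℝ) 1 →
      0 ≤ gainH ρ c n pH (threshold k x) := fun k x hx =>
    (gainH_pos hρ hc hn hH (isStrategy_threshold k hx)).le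
  have hB : ∀ (k : ℕ) {x : ℝ}, x ∈ Set.Icc (0 : ℝ) 1 →
      0 ≤ lossL ρ c n pL (threshold k x) := fun k x hx =>
    (lossL_pos hρ hc hn hL (isStrategy_threshold k hx)).le
  have up : ∀ {A B : ℝ}, 0 ≤ A → ∀ {s t : Fin m}, s ≤ t → B * a s ≤ A * b s →
      B * a t ≤ A * b t := fun hA s t hst h =>
    le_of_ratio_le hA (ha s) (ha t) (hb t) (hab s) (hr s t hst) h
  have down : ∀ {A B : ℝ}, 0 ≤ B → ∀ {s t : Fin m}, s ≤ t → A * b t ≤ B * a t →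
      A * b s ≤ B * a s := fun hB s t hst h =>
    le_of_ratio_le hB (hb t) (hb s) (ha s) (by linarith [hab t])
      (by linarith [hr s t hst]) h
  induction k with
  | zero =>
    have h1 : ∀ s : Fin m, (threshold 0 1 : Fin m → ℝ) s = 1 := by
      intro s
      simp [threshold]
    exact ⟨_, isStrategy_threshold 0 h11, fun _ => le_rfl, fun s =>
      ⟨fun h => absurd (h1 s) h.ne, fun _ => hacc s (Nat.zero_le _)⟩⟩
  | succ k ih =>
    let κ : Fin m := ⟨k, hk⟩
    by_cases h0 : gainH ρ c n pH (threshold (k + 1) 1) * b κ ≤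
        lossL ρ c n pL (threshold (k + 1) 1) * a κ
    · refine ⟨_, isStrategy_threshold (k + 1) h11, fun _ => le_rfl, fun s => ⟨fun h => ?_,
        fun h => ?_⟩⟩
      · have hs : s ≤ κ := by
          by_contra! h'
          have h' : k < s.val := h'
          refine h.ne ?_
          unfold threshold
          split_ifs <;> first | rfl | omega
        exact down (hB _ h11) hs h0
      · refine hacc s ?_
        by_contra! h'
        simp [threshold, h'] at h
    rw [not_le, threshold_succ] at h0
    by_cases h1 : lossL ρ c n pL (threshold k 1) * a κ ≤ gainH ρ c n pH (threshold k 1) * b κ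
    · obtain ⟨τ, h2, h3, h4⟩ := ih (by omega) fun s hs => up (hA _ h11) (s := κ) hs h1
      exact ⟨τ, h2, fun s => (threshold_one_le k zero_le_one s).trans (h3 s), h4⟩
    rw [not_le] at h1
    have hcont : Continuous fun x => lossL ρ c n pL (threshold k x) * a κ -
        gainH ρ c n pH (threshold k x) * b κ :=
      ((continuous_const.mul (continuous_visit_threshold n k pL)).mul continuous_const).sub
        ((continuous_const.mul (continuous_visit_threshold n k pH)).mul continuous_const)
    obtain ⟨x, hx, hx0⟩ := intermediate_value_Icc (zero_le_one' ℝ) hcont.continuousOn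
      (show (0 : ℝ) ∈ Set.Icc _ _ from ⟨by linarith, by linarith⟩)
    have hx0 : lossL ρ c n pL (threshold k x) * a κ = gainH ρ c n pH (threshold k x) * b κ :=
      sub_eq_zero.1 hx0
    refine ⟨_, isStrategy_threshold k hx, threshold_one_le k hx.1, fun s => ⟨fun h => ?_,
      fun h => ?_⟩⟩
    · refine down (hB _ hx) (t := κ) ?_ hx0.ge
      by_contra! h'
      have h' : k < s.val := h'
      refine h.ne ?_
      unfold threshold
      split_ifs <;> first | rfl | omega
    · refine up (hA _ hx) (s := κ) ?_ hx0.le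
      by_contra! hne
      have hne : s.val < k := hne
      simp [threshold, hne] at h

/-- Two signal distributions on a common index set, ordered by likelihood ratio, that agree
away from three consecutive signals `i < j < k`, where the first is supported on `j` and the
second on `i` and `k`. -/
structure IsLocalSpread {m : ℕ} (pL pH qL qH : Fin m → ℝ) (i j k : Fin m) : Prop where
  pL_pmf : IsPmf pL
  pH_pmf : IsPmf pH
  qL_pmf : IsPmf qL
  qH_pmf : IsPmf qH
  supp : ∀ s, 0 < (pL s + qL s) + (pH s + qH s)
  ratio : ∀ s t, s ≤ t → (pH s + qH s) * (pL t + qL t) ≤ (pH t + qH t) * (pL s + qL s)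
  lt_left : i < j
  lt_right : j < k
  null_left : pL i = 0 ∧ pH i = 0
  null_mid : qL j = 0 ∧ qH j = 0
  null_right : pL k = 0 ∧ pH k = 0
  agree : ∀ s, s < i ∨ k < s → qL s = pL s ∧ qH s = pH s
  cover : ∀ s, s = i ∨ s = j ∨ s = k ∨ s < i ∨ k < s

namespace IsLocalSpread

variable {m : ℕ} {pL pH qL qH : Fin m → ℝ} {i j k : Fin m}

lemma trichotomy (h : IsLocalSpread pL pH qL qH i j k) (s : Fin m) :
    (pL s = 0 ∧ pH s = 0) ∨ (qL s = 0 ∧ qH s = 0) ∨ (qL s = pL s ∧ qH s = pH s) := by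
  rcases h.cover s with rfl | rfl | rfl | hs | hs
  · exact Or.inl h.null_left
  · exact Or.inr (Or.inl h.null_mid)
  · exact Or.inl h.null_right
  · exact Or.inr (Or.inr (h.agree s (Or.inl hs)))
  · exact Or.inr (Or.inr (h.agree s (Or.inr hs)))

lemma accept_iff_left (h : IsLocalSpread pL pH qL qH i j k) {A B : ℝ} {s : Fin m}
    (hs : 0 < pL s + pH s) :
    B * pL s ≤ A * pH s ↔ B * (pL s + qL s) ≤ A * (pH s + qH s) := by
  rcases h.trichotomy s with ⟨h1, h2⟩ | ⟨h1, h2⟩ | ⟨h1, h2⟩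
  · simp [h1, h2] at hs
  · simp [h1, h2]
  · rw [h1, h2]; constructor <;> intro h <;> linarith

lemma accept_iff_right (h : IsLocalSpread pL pH qL qH i j k) {A B : ℝ} {s : Fin m}
    (hs : 0 < qL s + qH s) :
    B * qL s ≤ A * qH s ↔ B * (pL s + qL s) ≤ A * (pH s + qH s) := by
  rcases h.trichotomy s with ⟨h1, h2⟩ | ⟨h1, h2⟩ | ⟨h1, h2⟩
  · simp [h1, h2]
  · simp [h1, h2] at hs
  · rw [h1, h2]; constructor <;> intro h <;> linarith

lemma reject_iff_left (h : IsLocalSpread pL pH qL qH i j k) {A B : ℝ} {s : Fin m}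
    (hs : 0 < pL s + pH s) :
    A * pH s ≤ B * pL s ↔ A * (pH s + qH s) ≤ B * (pL s + qL s) := by
  rcases h.trichotomy s with ⟨h1, h2⟩ | ⟨h1, h2⟩ | ⟨h1, h2⟩
  · simp [h1, h2] at hs
  · simp [h1, h2]
  · rw [h1, h2]; constructor <;> intro h <;> linarith

lemma reject_iff_right (h : IsLocalSpread pL pH qL qH i j k) {A B : ℝ} {s : Fin m}
    (hs : 0 < qL s + qH s) :
    A * qH s ≤ B * qL s ↔ A * (pH s + qH s) ≤ B * (pL s + qL s) := by
  rcases h.trichotomy s with ⟨h1, h2⟩ | ⟨h1, h2⟩ | ⟨h1, h2⟩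
  · simp [h1, h2]
  · simp [h1, h2] at hs
  · rw [h1, h2]; constructor <;> intro h <;> linarith

lemma sumL_nonneg (h : IsLocalSpread pL pH qL qH i j k) (s : Fin m) : 0 ≤ pL s + qL s :=
  add_nonneg (h.pL_pmf.nonneg s) (h.qL_pmf.nonneg s)

lemma sumH_nonneg (h : IsLocalSpread pL pH qL qH i j k) (s : Fin m) : 0 ≤ pH s + qH s :=
  add_nonneg (h.pH_pmf.nonneg s) (h.qH_pmf.nonneg s)

lemma accept_mono (h : IsLocalSpread pL pH qL qH i j k) {A B : ℝ} (hA : 0 ≤ A) {s t : Fin m}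
    (hst : s ≤ t) (hs : B * (pL s + qL s) ≤ A * (pH s + qH s)) :
    B * (pL t + qL t) ≤ A * (pH t + qH t) :=
  le_of_ratio_le hA (h.sumL_nonneg s) (h.sumL_nonneg t) (h.sumH_nonneg t) (h.supp s)
    (h.ratio s t hst) hs

lemma reject_anti (h : IsLocalSpread pL pH qL qH i j k) {A B : ℝ} (hB : 0 ≤ B) {s t : Fin m}
    (hst : s ≤ t) (ht : A * (pH t + qH t) ≤ B * (pL t + qL t)) :
    A * (pH s + qH s) ≤ B * (pL s + qL s) :=
  le_of_ratio_le hB (h.sumH_nonneg t) (h.sumH_nonneg s) (h.sumL_nonneg s)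
    (by linarith [h.supp t]) (by linarith [h.ratio s t hst]) ht

lemma pos_left_mid (h : IsLocalSpread pL pH qL qH i j k) : 0 < pL j + pH j := by
  have := h.supp j
  rw [h.null_mid.1, h.null_mid.2] at this
  linarith

lemma pos_left_outer (h : IsLocalSpread pL pH qL qH i j k) {s : Fin m} (hs : s < i ∨ k < s) :
    0 < pL s + pH s := by
  have := h.supp s
  rw [(h.agree s hs).1, (h.agree s hs).2] at this
  linarith

lemma pos_right_of_ne (h : IsLocalSpread pL pH qL qH i j k) {s : Fin m} (hs : s ≠ j) :
    0 < qL s + qH s := by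
  have := h.supp s
  rcases h.cover s with rfl | rfl | rfl | hs | hs
  · rw [h.null_left.1, h.null_left.2] at this
    linarith
  · exact absurd rfl hs
  · rw [h.null_right.1, h.null_right.2] at this
    linarith
  · rw [← (h.agree s (Or.inl hs)).1, ← (h.agree s (Or.inl hs)).2] at this
    linarith
  · rw [← (h.agree s (Or.inr hs)).1, ← (h.agree s (Or.inr hs)).2] at this
    linarith

lemma rej_eq (h : IsLocalSpread pL pH qL qH i j k) {σ : Fin m → ℝ} (hi : σ i = 0)
    (hj : σ j = 0) (hk : σ k = 0) : rej qL σ = rej pL σ ∧ rej qH σ = rej pH σ := by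
  constructor <;> refine rej_congr fun s => ?_
  all_goals
    rcases h.cover s with rfl | rfl | rfl | hs | hs
    · simp [hi]
    · simp [hj]
    · simp [hk]
    · simp [h.agree s (Or.inl hs)]
    · simp [h.agree s (Or.inr hs)]

lemma weights_eq (h : IsLocalSpread pL pH qL qH i j k) (ρ c : ℝ) (n : ℕ) {σ : Fin m → ℝ}
    (hi : σ i = 0) (hj : σ j = 0) (hk : σ k = 0) :
    lossL ρ c n qL σ = lossL ρ c n pL σ ∧ gainH ρ c n qH σ = gainH ρ c n pH σ := by
  obtain ⟨h1, h2⟩ := h.rej_eq hi hj hk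
  simp only [lossL, gainH, visit, h1, h2, and_self]

variable {ρ c : ℝ} {n : ℕ} {σ τ : Fin m → ℝ}

lemma zero_of_ne_outer (h : IsLocalSpread pL pH qL qH i j k) (hρ : ρ ∈ Set.Ioo (0 : ℝ) 1)
    (hc : c ∈ Set.Ioo (0 : ℝ) 1) (hn : 1 ≤ n) (hσ : IsEquilibrium ρ c n pL pH σ) :
    σ i = 0 ∧ σ k = 0 := by
  obtain ⟨hσs, he⟩ := (isEquilibrium_iff hρ hc hn h.pL_pmf h.pH_pmf).1 hσ
  constructor
  · by_contra h'
    have := ((he i).2 ((hσs i).1.lt_of_ne' h')).2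
    linarith [h.null_left.1, h.null_left.2]
  · by_contra h'
    have := ((he k).2 ((hσs k).1.lt_of_ne' h')).2
    linarith [h.null_right.1, h.null_right.2]

lemma zero_of_eq_mid (h : IsLocalSpread pL pH qL qH i j k) (hρ : ρ ∈ Set.Ioo (0 : ℝ) 1)
    (hc : c ∈ Set.Ioo (0 : ℝ) 1) (hn : 1 ≤ n) (hτ : IsEquilibrium ρ c n qL qH τ) :
    τ j = 0 := by
  obtain ⟨hτs, he⟩ := (isEquilibrium_iff hρ hc hn h.qL_pmf h.qH_pmf).1 hτ
  by_contra hne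
  have := ((he j).2 ((hτs j).1.lt_of_ne' hne)).2
  linarith [h.null_mid.1, h.null_mid.2]

/-- An equilibrium of the spread experiment rejecting at the new signals is an equilibrium of
the original one. -/
lemma isEquilibrium_left (h : IsLocalSpread pL pH qL qH i j k) (hρ : ρ ∈ Set.Ioo (0 : ℝ) 1)
    (hc : c ∈ Set.Ioo (0 : ℝ) 1) (hn : 1 ≤ n) (hτ : IsEquilibrium ρ c n qL qH τ)
    (hi : τ i = 0) (hk : τ k = 0) : IsEquilibrium ρ c n pL pH τ := by
  have hj := h.zero_of_eq_mid hρ hc hn hτ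
  obtain ⟨hτs, he⟩ := (isEquilibrium_iff hρ hc hn h.qL_pmf h.qH_pmf).1 hτ
  have hB := (lossL_pos hρ hc hn h.qL_pmf hτs).le
  obtain ⟨w1, w2⟩ := h.weights_eq ρ c n hi hj hk
  refine (isEquilibrium_iff hρ hc hn h.pL_pmf h.pH_pmf).2 ⟨hτs, fun s => ?_⟩
  rw [← w1, ← w2]
  rcases h.cover s with rfl | rfl | rfl | hs | hs
  · simp [hi, h.null_left]
  · refine ⟨fun _ => (h.reject_iff_left h.pos_left_mid).2 (h.reject_anti hB h.lt_right.le ?_),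
      fun h' => absurd hj h'.ne'⟩
    exact (h.reject_iff_right (h.pos_right_of_ne h.lt_right.ne')).1
      ((he k).1 (by rw [hk]; exact zero_lt_one))
  · simp [hk, h.null_right]
  · rw [← (h.agree s (Or.inl hs)).1, ← (h.agree s (Or.inl hs)).2]
    exact he s
  · rw [← (h.agree s (Or.inr hs)).1, ← (h.agree s (Or.inr hs)).2]
    exact he s

/-- An equilibrium that rejects at the spread signal, and from which no equilibrium is reached by
raising acceptance at one signal and lowering it at another, rejects everything below. -/
lemma zero_below (h : IsLocalSpread pL pH qL qH i j k) (hρ : ρ ∈ Set.Ioo (0 : ℝ) 1)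
    (hc : c ∈ Set.Ioo (0 : ℝ) 1) (hn : 1 ≤ n) (hσ : IsEquilibrium ρ c n pL pH σ)
    (hj : σ j = 0)
    (hext : ∀ σ', IsEquilibrium ρ c n pL pH σ' → ∀ s t, σ' t < σ t → ¬ σ s < σ' s)
    {s : Fin m} (hs : s < i) : σ s = 0 := by
  obtain ⟨hσs, he⟩ := (isEquilibrium_iff hρ hc hn h.pL_pmf h.pH_pmf).1 hσ
  have hA := (gainH_pos hρ hc hn h.pH_pmf hσs).le
  have hB := (lossL_pos hρ hc hn h.pL_pmf hσs).le
  have hsj : s < j := hs.trans h.lt_left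
  by_contra h'
  have hpos : 0 < σ s := (hσs s).1.lt_of_ne' h'
  have hj1 : σ j < 1 := by rw [hj]; exact zero_lt_one
  obtain ⟨hacc, hnull⟩ := (he s).2 hpos
  have haccj := (h.accept_iff_left h.pos_left_mid).2
    (h.accept_mono hA hsj.le ((h.accept_iff_left hnull).1 hacc))
  have hrejs := (h.reject_iff_left hnull).2
    (h.reject_anti hB hsj.le ((h.reject_iff_left h.pos_left_mid).1 ((he j).1 hj1)))
  obtain ⟨σ', h1, h2, h3⟩ := exists_shifted_equilibrium hρ hc hn h.pL_pmf h.pH_pmf hσ hsj.ne'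
    hpos hj1 h.pos_left_mid haccj hrejs
  exact hext σ' h1 j s h2 h3

lemma le_of_above (h : IsLocalSpread pL pH qL qH i j k)
    (hσ : IsStrategy σ) (hτ : IsStrategy τ) (hi : σ i = 0) (hj : σ j = 0) (hk : σ k = 0)
    (hbelow : ∀ s, s < i → σ s = 0) (habove : ∀ s, k < s → τ s < 1 → σ s ≤ τ s) (s : Fin m) :
    σ s ≤ τ s := by
  have h0 := (hτ s).1
  rcases h.cover s with rfl | rfl | rfl | hs | hs
  · rwa [hi]
  · rwa [hj]
  · rwa [hk]
  · rwa [hbelow s hs]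
  · rcases (hτ s).2.lt_or_eq with h1 | h1
    · exact habove s hs h1
    · rw [h1]
      exact (hσ s).2

lemma mostSelective_le (h : IsLocalSpread pL pH qL qH i j k) (hρ : ρ ∈ Set.Ioo (0 : ℝ) 1)
    (hc : c ∈ Set.Ioo (0 : ℝ) 1) (hn : 1 ≤ n) (hσ : MostSelective ρ c n pL pH σ)
    (hτ : MostSelective ρ c n qL qH τ) (hj : σ j = 0) (s : Fin m) : σ s ≤ τ s := by
  obtain ⟨hσe, hσm⟩ := hσ
  obtain ⟨hτe, hτm⟩ := hτ
  obtain ⟨hτs, he⟩ := (isEquilibrium_iff hρ hc hn h.qL_pmf h.qH_pmf).1 hτe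
  by_cases h0 : τ i = 0 ∧ τ k = 0
  · exact hσm τ (h.isEquilibrium_left hρ hc hn hτe h0.1 h0.2) s
  obtain ⟨t, htj, htk, ht⟩ : ∃ t, t ≠ j ∧ t ≤ k ∧ 0 < τ t := by
    by_cases hti : τ i = 0
    · exact ⟨k, h.lt_right.ne', le_rfl, (hτs k).1.lt_of_ne' fun hk => h0 ⟨hti, hk⟩⟩
    · exact ⟨i, h.lt_left.ne, (h.lt_left.trans h.lt_right).le, (hτs i).1.lt_of_ne' hti⟩
  obtain ⟨hi, hk⟩ := h.zero_of_ne_outer hρ hc hn hσe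
  refine h.le_of_above hσe.1 hτs hi hj hk (fun s hs => h.zero_below hρ hc hn hσe hj
    (fun σ' h1 _ t h2 _ => (hσm σ' h1 t).not_gt h2) hs) (fun s hs hs1 => ?_) s
  exfalso
  have hts : t < s := htk.trans_lt hs
  have hA := (gainH_pos hρ hc hn h.qH_pmf hτs).le
  have hB := (lossL_pos hρ hc hn h.qL_pmf hτs).le
  have hsn := h.pos_right_of_ne (h.lt_right.trans hs).ne'
  have htn := h.pos_right_of_ne htj
  have haccs := (h.accept_iff_right hsn).2
    (h.accept_mono hA hts.le ((h.accept_iff_right htn).1 ((he t).2 ht).1))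
  have hrejt := (h.reject_iff_right htn).2
    (h.reject_anti hB hts.le ((h.reject_iff_right hsn).1 ((he s).1 hs1)))
  obtain ⟨τ', h1, h2, _⟩ := exists_shifted_equilibrium hρ hc hn h.qL_pmf h.qH_pmf hτe hts.ne'
    ht hs1 hsn haccs hrejt
  exact (hτm τ' h1 t).not_gt h2

lemma leastSelective_le (h : IsLocalSpread pL pH qL qH i j k) (hρ : ρ ∈ Set.Ioo (0 : ℝ) 1)
    (hc : c ∈ Set.Ioo (0 : ℝ) 1) (hn : 1 ≤ n) (hσ : LeastSelective ρ c n pL pH σ)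
    (hτ : LeastSelective ρ c n qL qH τ) (hj : σ j = 0) (s : Fin m) : σ s ≤ τ s := by
  obtain ⟨hσe, hσm⟩ := hσ
  obtain ⟨_, hτm⟩ := hτ
  obtain ⟨hσs, he⟩ := (isEquilibrium_iff hρ hc hn h.pL_pmf h.pH_pmf).1 hσe
  obtain ⟨hi, hk⟩ := h.zero_of_ne_outer hρ hc hn hσe
  obtain ⟨w1, w2⟩ := h.weights_eq ρ c n hi hj hk
  have hA := (gainH_pos hρ hc hn h.pH_pmf hσs).le
  have hB := (lossL_pos hρ hc hn h.pL_pmf hσs).le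
  have hbelow : ∀ s, s < i → σ s = 0 := fun s hs => h.zero_below hρ hc hn hσe hj
    (fun σ' h1 s _ _ h3 => (hσm σ' h1 s).not_gt h3) hs
  by_cases hrej : gainH ρ c n pH σ * (pH k + qH k) ≤ lossL ρ c n pL σ * (pL k + qL k)
  · refine hτm σ ((isEquilibrium_iff hρ hc hn h.qL_pmf h.qH_pmf).2 ⟨hσs, fun s => ?_⟩) s
    rw [w1, w2]
    rcases h.cover s with rfl | rfl | rfl | hs | hs
    · exact ⟨fun _ => (h.reject_iff_right (h.pos_right_of_ne h.lt_left.ne)).2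
        (h.reject_anti hB (h.lt_left.trans h.lt_right).le hrej), fun h' => absurd hi h'.ne'⟩
    · simp [hj, h.null_mid]
    · exact ⟨fun _ => (h.reject_iff_right (h.pos_right_of_ne h.lt_right.ne')).2 hrej,
        fun h' => absurd hk h'.ne'⟩
    · rw [(h.agree s (Or.inl hs)).1, (h.agree s (Or.inl hs)).2]
      exact he s
    · rw [(h.agree s (Or.inr hs)).1, (h.agree s (Or.inr hs)).2]
      exact he s
  have habove : ∀ s, k < s → σ s = 1 := by
    intro s hs
    by_contra h'
    have h1 := (he s).1 ((hσs s).2.lt_of_ne h')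
    exact hrej (h.reject_anti hB hs.le ((h.reject_iff_left (h.pos_left_outer (Or.inr hs))).1 h1))
  have hthr : σ = threshold (k.val + 1) 1 := by
    funext s
    by_cases hs : k < s
    · have h1 : ¬ s.val < k.val + 1 := by have : k.val < s.val := hs; omega
      simp [threshold, h1, habove s hs]
    · have h1 : s.val < k.val + 1 := by have : ¬ k.val < s.val := hs; omega
      rw [threshold, if_pos h1]
      rcases h.cover s with rfl | rfl | rfl | hs' | hs'
      · exact hi
      · exact hj
      · exact hk
      · exact hbelow s hs'
      · exact absurd hs' hs
  obtain ⟨υ, hυs, hυ, hbr⟩ := exists_bestResponse_ge_threshold hρ hc hn h.qL_pmf h.qH_pmf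
    h.sumL_nonneg h.sumH_nonneg h.supp h.ratio (k.val + 1) k.isLt (fun s hs => by
      rw [← hthr, w1, w2]
      exact h.accept_mono hA (Nat.le_of_succ_le hs) (not_le.1 hrej).le)
  rw [← hthr] at hυ
  have hrejυ : ∀ p : Fin m → ℝ, p j = 0 → rej p (Function.update υ j 0) = rej p υ := by
    intro p hp
    unfold rej
    congr 1
    refine Finset.sum_congr rfl fun s _ => ?_
    by_cases hs : s = j
    · simp [hs, hp]
    · simp [hs]
  have hυe : IsEquilibrium ρ c n qL qH (Function.update υ j 0) := by
    refine (isEquilibrium_iff hρ hc hn h.qL_pmf h.qH_pmf).2 ⟨fun s => ?_, fun s => ?_⟩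
    · by_cases hs : s = j
      · simp [hs]
      · simpa [hs] using hυs s
    · simp only [gainH, lossL, visit, hrejυ qL h.null_mid.1, hrejυ qH h.null_mid.2]
      by_cases hs : s = j
      · subst hs
        simp [h.null_mid]
      · rw [Function.update_of_ne hs]
        have hsn := h.pos_right_of_ne hs
        exact ⟨fun h1 => (h.reject_iff_right hsn).2 ((hbr s).1 h1),
          fun h1 => ⟨(h.accept_iff_right hsn).2 ((hbr s).2 h1), hsn⟩⟩
  refine le_trans ?_ (hτm _ hυe s)
  by_cases hs : s = j
  · simp [hs, hj]
  · simpa [hs] using hυ s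

lemma surplus_le (h : IsLocalSpread pL pH qL qH i j k) (hρ : ρ ∈ Set.Ioo (0 : ℝ) 1)
    (hc : c ∈ Set.Ioo (0 : ℝ) 1) (hn : 1 ≤ n) (hσ : IsEquilibrium ρ c n pL pH σ)
    (hτ : IsEquilibrium ρ c n qL qH τ) (hj : σ j = 0) (hle : ∀ s, σ s ≤ τ s)
    (hirr : ρ * (1 - c) * rej pH σ ^ (n - 1) * qH k ≤
      c * (1 - ρ) * rej pL σ ^ (n - 1) * qL k) :
    surplus ρ c n qL qH τ ≤ surplus ρ c n pL pH σ := by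
  obtain ⟨hσs, he⟩ := (isEquilibrium_iff hρ hc hn h.pL_pmf h.pH_pmf).1 hσ
  obtain ⟨hi, hk⟩ := h.zero_of_ne_outer hρ hc hn hσ
  obtain ⟨r1, r2⟩ := h.rej_eq hi hj hk
  have hB := (lossL_pos hρ hc hn h.pL_pmf hσs).le
  have heq : surplus ρ c n pL pH σ = surplus ρ c n qL qH σ := by simp only [surplus, r1, r2]
  rw [heq]
  refine surplus_le_of_social_le hρ hc hn h.qL_pmf h.qH_pmf hσs hτ hle fun s hs => ?_
  rw [r1, r2]
  have hs1 : σ s < 1 := hs.trans_le (hτ.1 s).2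
  have hsoc := social_le_of_private_le hρ hc hn h.pL_pmf h.pH_pmf hσ (h.qH_pmf.nonneg s)
    (x := qL s)
  rcases h.cover s with rfl | rfl | rfl | hs' | hs'
  · refine hsoc ((h.reject_iff_right (h.pos_right_of_ne h.lt_left.ne)).2
      (h.reject_anti hB h.lt_left.le ((h.reject_iff_left h.pos_left_mid).1
        ((he j).1 (by rw [hj]; exact zero_lt_one)))))
  · simp [h.null_mid]
  · exact hirr
  · refine hsoc ?_
    rw [(h.agree s (Or.inl hs')).1, (h.agree s (Or.inl hs')).2]
    exact (he s).1 hs1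
  · refine hsoc ?_
    rw [(h.agree s (Or.inr hs')).1, (h.agree s (Or.inr hs')).2]
    exact (he s).1 hs1

end IsLocalSpread

/-- positive overrides lower surplus unless adverse selection is
irrelevant. `E' = (qL, qH)` differs from `E = (pL, pH)` by a local mean preserving
spread at index `j` of the joint outcome set `Fin M`. If the most (resp. least)
selective equilibrium strategy `σ` of `E` rejects at `j` for sure, and adverse
selection is not `σ`-irrelevant for the new outcome `j+1`, i.e.
`ρ(1-c)·r_H(σ)^{n-1}·q_H(s_{j+1}) ≤ c(1-ρ)·r_L(σ)^{n-1}·q_L(s_{j+1})`, then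
extremal-equilibrium surplus under `E'` is weakly below that under `E`. -/
theorem positive_override_lowers_surplus
    (ρ c : ℝ) (hρ : ρ ∈ Set.Ioo (0:ℝ) 1) (hc : c ∈ Set.Ioo (0:ℝ) 1)
    (n : ℕ) (hn : 1 ≤ n) (M : ℕ)
    (pL pH qL qH : Fin M → ℝ)
    (hpL0 : ∀ s, 0 ≤ pL s) (hpH0 : ∀ s, 0 ≤ pH s)
    (hqL0 : ∀ s, 0 ≤ qL s) (hqH0 : ∀ s, 0 ≤ qH s)
    (hpLsum : ∑ s, pL s = 1) (hpHsum : ∑ s, pH s = 1)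
    (hqLsum : ∑ s, qL s = 1) (hqHsum : ∑ s, qH s = 1)
    (hsupp : ∀ s, 0 < pL s + pH s + qL s + qH s)
    (hLR : ∀ i k : Fin M, i ≤ k →
      (pH i + qH i) * (pL k + qL k) ≤ (pH k + qH k) * (pL i + qL i))
    (j : ℕ) (hj1 : 1 ≤ j) (hj2 : j + 1 < M)
    (hqjL : qL ⟨j, by omega⟩ = 0) (hqjH : qH ⟨j, by omega⟩ = 0)
    (hpjmL : pL ⟨j - 1, by omega⟩ = 0) (hpjmH : pH ⟨j - 1, by omega⟩ = 0)
    (hpjpL : pL ⟨j + 1, by omega⟩ = 0) (hpjpH : pH ⟨j + 1, by omega⟩ = 0)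
    (hsplitL : qL ⟨j - 1, by omega⟩ + qL ⟨j + 1, by omega⟩ = pL ⟨j, by omega⟩)
    (hsplitH : qH ⟨j - 1, by omega⟩ + qH ⟨j + 1, by omega⟩ = pH ⟨j, by omega⟩)
    (hagree : ∀ s : Fin M, s.val ≠ j - 1 → s.val ≠ j → s.val ≠ j + 1 →
      qL s = pL s ∧ qH s = pH s) :
    (∀ σE σE' : Fin M → ℝ, MostSelective ρ c n pL pH σE →
      MostSelective ρ c n qL qH σE' → σE ⟨j, by omega⟩ = 0 →
      ρ * (1 - c) * rej pH σE ^ (n - 1) * qH ⟨j + 1, by omega⟩ ≤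
        c * (1 - ρ) * rej pL σE ^ (n - 1) * qL ⟨j + 1, by omega⟩ →
      surplus ρ c n qL qH σE' ≤ surplus ρ c n pL pH σE) ∧
    (∀ σE σE' : Fin M → ℝ, LeastSelective ρ c n pL pH σE →
      LeastSelective ρ c n qL qH σE' → σE ⟨j, by omega⟩ = 0 →
      ρ * (1 - c) * rej pH σE ^ (n - 1) * qH ⟨j + 1, by omega⟩ ≤
        c * (1 - ρ) * rej pL σE ^ (n - 1) * qL ⟨j + 1, by omega⟩ →
      surplus ρ c n qL qH σE' ≤ surplus ρ c n pL pH σE) := by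
  have h : IsLocalSpread pL pH qL qH ⟨j - 1, by omega⟩ ⟨j, by omega⟩ ⟨j + 1, hj2⟩ :=
    { pL_pmf := ⟨hpL0, hpLsum⟩
      pH_pmf := ⟨hpH0, hpHsum⟩
      qL_pmf := ⟨hqL0, hqLsum⟩
      qH_pmf := ⟨hqH0, hqHsum⟩
      supp := fun s => by linarith [hsupp s]
      ratio := hLR
      lt_left := by simp only [Fin.mk_lt_mk]; omega
      lt_right := by simp only [Fin.mk_lt_mk]; omega
      null_left := ⟨hpjmL, hpjmH⟩
      null_mid := ⟨hqjL, hqjH⟩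
      null_right := ⟨hpjpL, hpjpH⟩
      agree := fun s hs => by
        simp only [Fin.lt_def] at hs
        exact hagree s (by omega) (by omega) (by omega)
      cover := fun s => by
        simp only [Fin.lt_def, Fin.ext_iff]
        omega }
  exact ⟨fun _ _ hσ hσ' hj hirr => h.surplus_le hρ hc hn hσ.1 hσ'.1 hj
      (h.mostSelective_le hρ hc hn hσ hσ' hj) hirr,
    fun _ _ hσ hσ' hj hirr => h.surplus_le hρ hc hn hσ.1 hσ'.1 hj
      (h.leastSelective_le hρ hc hn hσ hσ' hj) hirr⟩
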